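/- arXiv:2511.06880 — 2 statements merged into one kernel-verified Lean document; each statement's English description precedes it below -/
import Mathlib

section
/- Dévissage for regular rings: let A be a commutative noetherian ring such that the localization A_𝔭 is a regular local ring for every prime ideal 𝔭 of A. Then the natural group homomorphism K₀(A) → G₀(A), sending the class of a finitely generated projective A-module to its class as a finitely generated A-module, is an isomorphism. -/
universe u

variable (R : Type u) [CommRing R]

/-- The (bundled) finitely generated `R`-modules. -/
def FGMod := { M : ModuleCat.{u} R // Module.Finite R M }

/-- The (bundled) finitely generated projective `R`-modules. -/
def FGProj := { M : ModuleCat.{u} R // Module.Finite R M ∧ Module.Projective R M }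

/-- Isomorphism classes of finitely generated modules. -/
instance FGMod.setoid : Setoid (FGMod R) where
  r M N := Nonempty (M.1 ≃ₗ[R] N.1)
  iseqv := ⟨fun M => ⟨LinearEquiv.refl R M.1⟩,
    fun ⟨e⟩ => ⟨e.symm⟩, fun ⟨e⟩ ⟨f⟩ => ⟨e.trans f⟩⟩

/-- Isomorphism classes of finitely generated projective modules. -/
instance FGProj.setoid : Setoid (FGProj R) where
  r M N := Nonempty (M.1 ≃ₗ[R] N.1)
  iseqv := ⟨fun M => ⟨LinearEquiv.refl R M.1⟩,
    fun ⟨e⟩ => ⟨e.symm⟩, fun ⟨e⟩ ⟨f⟩ => ⟨e.trans f⟩⟩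

/-- The relations defining `G₀(R)`: one for each short exact sequence
`0 → M' → M → M'' → 0` of finitely generated `R`-modules. -/
def G0Rels : Set (FreeAbelianGroup (Quotient (FGMod.setoid R))) :=
  { x | ∃ (M' M M'' : FGMod R) (f : M'.1 →ₗ[R] M.1) (g : M.1 →ₗ[R] M''.1),
      Function.Injective f ∧ Function.Surjective g ∧
        LinearMap.range f = LinearMap.ker g ∧
      x = FreeAbelianGroup.of ⟦M⟧ - FreeAbelianGroup.of ⟦M'⟧ -
        FreeAbelianGroup.of ⟦M''⟧ }

/-- The relations defining `K₀(R)`: one for each short exact sequence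
`0 → M' → M → M'' → 0` of finitely generated projective `R`-modules. -/
def K0Rels : Set (FreeAbelianGroup (Quotient (FGProj.setoid R))) :=
  { x | ∃ (M' M M'' : FGProj R) (f : M'.1 →ₗ[R] M.1) (g : M.1 →ₗ[R] M''.1),
      Function.Injective f ∧ Function.Surjective g ∧
        LinearMap.range f = LinearMap.ker g ∧
      x = FreeAbelianGroup.of ⟦M⟧ - FreeAbelianGroup.of ⟦M'⟧ -
        FreeAbelianGroup.of ⟦M''⟧ }

/-- `G₀(R)`, the Grothendieck group of finitely generated `R`-modules. -/
def G0 := FreeAbelianGroup (Quotient (FGMod.setoid R)) ⧸ AddSubgroup.closure (G0Rels R)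

/-- `K₀(R)`, the Grothendieck group of finitely generated projective `R`-modules. -/
def K0 := FreeAbelianGroup (Quotient (FGProj.setoid R)) ⧸ AddSubgroup.closure (K0Rels R)

noncomputable instance : AddCommGroup (G0 R) := QuotientAddGroup.Quotient.addCommGroup _
noncomputable instance : AddCommGroup (K0 R) := QuotientAddGroup.Quotient.addCommGroup _

/-- The class in `G₀(R)` of a finitely generated module. -/
def G0.mk {R : Type u} [CommRing R] (M : FGMod R) : G0 R :=
  QuotientAddGroup.mk (FreeAbelianGroup.of ⟦M⟧)

/-- The class in `K₀(R)` of a finitely generated projective module. -/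
def K0.mk {R : Type u} [CommRing R] (M : FGProj R) : K0 R :=
  QuotientAddGroup.mk (FreeAbelianGroup.of ⟦M⟧)

/-- The class in `G₀(R)` of an unbundled finitely generated module. -/
def G0.of {R : Type u} [CommRing R] (M : Type u) [AddCommGroup M] [Module R M]
    [Module.Finite R M] : G0 R :=
  G0.mk ⟨ModuleCat.of R M, ‹_›⟩

/-- The class in `K₀(R)` of an unbundled finitely generated projective module. -/
def K0.of {R : Type u} [CommRing R] (M : Type u) [AddCommGroup M] [Module R M]
    [Module.Finite R M] [hp : Module.Projective R M] : K0 R :=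
  K0.mk ⟨ModuleCat.of R M, ‹_›, ‹_›⟩

/-- A commutative local ring is regular if it is noetherian and its Krull
dimension equals the dimension of the cotangent space `𝔪/𝔪²` over the residue
field `k = A/𝔪`. -/
def IsRegularLocal (B : Type u) [CommRing B] [IsLocalRing B] : Prop :=
  IsNoetherianRing B ∧
    ringKrullDim B =
      (Module.finrank (IsLocalRing.ResidueField B) (IsLocalRing.CotangentSpace B) :
        WithBot ℕ∞)

section RegularLocal

open IsLocalRing CategoryTheory

theorem IsLocalRing.spanFinrank_maximalIdeal_quotient_span_singleton_add_one_le
    {R : Type*} [CommRing R] [IsLocalRing R] [IsNoetherianRing R] {x : R}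
    (hx : x ∈ maximalIdeal R) (hx2 : x ∉ maximalIdeal R ^ 2)
    [IsLocalRing (R ⧸ Ideal.span {x})] :
    (maximalIdeal (R ⧸ Ideal.span {x})).spanFinrank + 1 ≤ (maximalIdeal R).spanFinrank := by
  classical
  obtain ⟨s, hcard, hs⟩ := Submodule.FG.exists_span_finset_card_eq_spanFinrank
    (maximalIdeal R).fg_of_isNoetherianRing
  obtain ⟨f, -, hf⟩ := Submodule.mem_span_finset.mp (hs ▸ hx : x ∈ Submodule.span R (s : Set R))
  have hsm : ∀ i ∈ s, i ∈ maximalIdeal R := fun i hi ↦ hs ▸ Submodule.subset_span hi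
  obtain ⟨j, hj, hfj⟩ : ∃ j ∈ s, f j ∉ maximalIdeal R := by
    by_contra! h
    refine hx2 ?_
    rw [← hf, pow_two]
    exact Ideal.sum_mem _ fun i hi ↦ Ideal.mul_mem_mul (h i hi) (hsm i hi)
  have hu : IsUnit (f j) := by simpa using hfj
  let π := Ideal.Quotient.mk (Ideal.span {x})
  let t : Finset (R ⧸ Ideal.span {x}) := (s.erase j).image π
  have key : ∀ i ∈ s.erase j, π i ∈ Ideal.span (t : Set (R ⧸ Ideal.span {x})) :=
    fun i hi ↦ Ideal.subset_span (Finset.mem_image_of_mem _ hi)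
  have hspan : maximalIdeal (R ⧸ Ideal.span {x}) = Ideal.span (t : Set (R ⧸ Ideal.span {x})) := by
    rw [← map_maximalIdeal_of_surjective π Ideal.Quotient.mk_surjective]
    apply le_antisymm
    · have hs' : Ideal.span (s : Set R) = maximalIdeal R := hs
      rw [← hs', Ideal.map_span, Ideal.span_le]
      rintro _ ⟨i, hi, rfl⟩
      by_cases hij : i = j
      · have hx0 : π (∑ a ∈ s, f a • a) = 0 := by
          rw [hf]
          exact Ideal.Quotient.eq_zero_iff_mem.mpr (Ideal.mem_span_singleton_self x)
        rw [← Finset.add_sum_erase _ _ hj, map_add, smul_eq_mul, map_mul, map_sum] at hx0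
        rw [hij]
        refine (Ideal.unit_mul_mem_iff_mem _ (hu.map π)).mp ?_
        rw [eq_neg_of_add_eq_zero_left hx0]
        refine neg_mem (Ideal.sum_mem _ fun k hk ↦ ?_)
        rw [smul_eq_mul, map_mul]
        exact Ideal.mul_mem_left _ _ (key k hk)
      · exact key i (Finset.mem_erase.mpr ⟨hij, hi⟩)
    · rw [Ideal.span_le]
      intro y hy
      obtain ⟨i, hi, rfl⟩ := Finset.mem_image.mp hy
      exact Ideal.mem_map_of_mem _ (hsm i (Finset.mem_of_mem_erase hi))
  have hle : (maximalIdeal (R ⧸ Ideal.span {x})).spanFinrank ≤ t.card := by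
    rw [hspan, ← Set.ncard_coe_finset]
    exact Submodule.spanFinrank_span_le_ncard_of_finite t.finite_toSet
  have hle' : t.card ≤ (s.erase j).card := Finset.card_image_le
  rw [Finset.card_erase_of_mem hj] at hle'
  have := Finset.card_pos.mpr ⟨j, hj⟩
  lia

theorem IsLocalRing.isLocalRing_quotient_span_singleton {R : Type*} [CommRing R] [IsLocalRing R]
    {x : R} (hx : x ∈ maximalIdeal R) : IsLocalRing (R ⧸ Ideal.span {x}) := by
  have : Nontrivial (R ⧸ Ideal.span {x}) :=
    Ideal.Quotient.nontrivial_iff.mpr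
      (Ideal.span_singleton_eq_top.not.mpr ((mem_maximalIdeal x).mp hx))
  exact .of_surjective' _ Ideal.Quotient.mk_surjective

theorem IsRegularLocalRing.quotient_span_singleton {R : Type*} [CommRing R]
    [IsRegularLocalRing R] {x : R} (hx : x ∈ maximalIdeal R) (hx2 : x ∉ maximalIdeal R ^ 2) :
    IsRegularLocalRing (R ⧸ Ideal.span {x}) := by
  have := isLocalRing_quotient_span_singleton hx
  apply of_spanFinrank_maximalIdeal_le
  have h1 := ringKrullDim_le_ringKrullDim_quotient_add_card {x} (by
    simpa [IsLocalRing.ringJacobson_eq_maximalIdeal] using hx)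
  rw [Finset.coe_singleton, Finset.card_singleton, Nat.cast_one,
    ← spanFinrank_maximalIdeal (R := R)] at h1
  have h2 := spanFinrank_maximalIdeal_quotient_span_singleton_add_one_le hx hx2
  have h3 : (((maximalIdeal (R ⧸ Ideal.span {x})).spanFinrank + 1 : ℕ) : WithBot ℕ∞) ≤
    ((maximalIdeal R).spanFinrank : ℕ) := by exact_mod_cast h2
  have h4 := h3.trans h1
  rw [Nat.cast_add, Nat.cast_one] at h4
  exact (ENat.WithBot.add_le_add_one_right_iff).mp h4

theorem IsLocalRing.maximalIdeal_not_le_sq {R : Type*} [CommRing R] [IsLocalRing R]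
    [IsNoetherianRing R] (h : maximalIdeal R ≠ ⊥) : ¬ maximalIdeal R ≤ maximalIdeal R ^ 2 := by
  intro hle
  refine h (Submodule.eq_bot_of_le_smul_of_le_jacobson_bot (maximalIdeal R) _
    (maximalIdeal R).fg_of_isNoetherianRing ?_ (maximalIdeal_le_jacobson _))
  rwa [smul_eq_mul, ← pow_two]

theorem IsRegularLocalRing.isDomain (R : Type u) [CommRing R] [IsRegularLocalRing R] :
    IsDomain R := by
  classical
  induction hd : (maximalIdeal R).spanFinrank using Nat.strong_induction_on generalizing R with
  | _ d ih =>
  by_cases h0 : maximalIdeal R = ⊥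
  · exact (isField_iff_maximalIdeal_eq.mpr h0).isDomain
  have hdpos : d ≠ 0 := by
    rw [← hd]
    exact fun h ↦ h0 ((Submodule.spanFinrank_eq_zero_iff_eq_bot
      (maximalIdeal R).fg_of_isNoetherianRing).mp h)
  have hmin : maximalIdeal R ∉ minimalPrimes R := by
    intro hm
    have h1 := maximalIdeal_height_eq_ringKrullDim (R := R)
    rw [← spanFinrank_maximalIdeal (R := R), hd, Ideal.height_eq_zero_iff.mpr hm] at h1
    exact hdpos (by exact_mod_cast h1.symm)
  obtain ⟨x, hx, hxn⟩ : ∃ x ∈ maximalIdeal R, x ∉ maximalIdeal R ^ 2 ∧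
      ∀ P ∈ minimalPrimes R, x ∉ P := by
    by_contra! hcon
    have hfin := minimalPrimes.finite_of_isNoetherianRing R
    obtain ⟨I, hI, hle⟩ := (Ideal.subset_union_prime (f := id)
      (s := insert (maximalIdeal R ^ 2) hfin.toFinset) (maximalIdeal R ^ 2) (maximalIdeal R ^ 2)
      (I := maximalIdeal R) (by
        intro i hi hne _
        have : i ∈ minimalPrimes R := by simpa [hne] using hi
        exact this.1.1)).mp (by
        intro y hy
        by_cases hy2 : y ∈ maximalIdeal R ^ 2
        · exact Set.mem_biUnion (Finset.mem_coe.mpr (Finset.mem_insert_self _ _)) hy2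
        · obtain ⟨P, hP, hyP⟩ := hcon y hy hy2
          exact Set.mem_biUnion (Finset.mem_coe.mpr
            (Finset.mem_insert_of_mem (hfin.mem_toFinset.mpr hP))) hyP)
    rcases Finset.mem_insert.mp hI with rfl | hI
    · exact maximalIdeal_not_le_sq h0 hle
    · have hI' := hfin.mem_toFinset.mp hI
      have := hI'.1.1
      have : I = maximalIdeal R := le_antisymm (le_maximalIdeal this.ne_top) hle
      exact hmin (this ▸ hI')
  have hreg := quotient_span_singleton hx hxn.1
  have hdom := ih _ (by
    have := spanFinrank_maximalIdeal_quotient_span_singleton_add_one_le hx hxn.1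
    lia) (R ⧸ Ideal.span {x}) rfl
  have hprime : (Ideal.span {x}).IsPrime := (Ideal.Quotient.isDomain_iff_prime _).mp hdom
  obtain ⟨P, hP, hPx⟩ := Ideal.exists_minimalPrimes_le (I := (⊥ : Ideal R)) (J := Ideal.span {x})
    bot_le
  have hxP : x ∉ P := hxn.2 P hP
  have hPprime : P.IsPrime := hP.1.1
  have hPbot : P = ⊥ := by
    refine Submodule.eq_bot_of_le_smul_of_le_jacobson_bot (maximalIdeal R) _
      P.fg_of_isNoetherianRing ?_ (maximalIdeal_le_jacobson _)
    intro p hp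
    obtain ⟨a, rfl⟩ := Ideal.mem_span_singleton'.mp (hPx hp)
    rw [mul_comm]
    exact Submodule.smul_mem_smul hx ((hPprime.mem_or_mem hp).resolve_right hxP)
  subst hPbot
  exact IsDomain.of_bot_isPrime R

theorem IsLocalRing.hasProjectiveDimensionLE_of_quotSMulTop {R : Type u} [CommRing R]
    [IsLocalRing R] [IsNoetherianRing R] [IsDomain R] {x : R} (hx : x ∈ maximalIdeal R)
    (hx0 : x ≠ 0) (n : ℕ) (M : ModuleCat.{u} R) [Module.Finite R M]
    (hxM : IsSMulRegular M x)
    (h : HasProjectiveDimensionLE (ModuleCat.of (R ⧸ Ideal.span {x}) (QuotSMulTop x M)) n) :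
    HasProjectiveDimensionLE M n := by
  have := isLocalRing_quotient_span_singleton hx
  induction n generalizing M with
  | zero =>
    rw [← projective_iff_hasProjectiveDimensionLE_zero, ← IsProjective.iff_projective] at h ⊢
    have := Module.finitePresentation_of_finite R M
    have : Module.Finite (R ⧸ Ideal.span {x}) (QuotSMulTop x M) :=
      .of_restrictScalars_finite R _ _
    have : Module.Free (R ⧸ Ideal.span {x}) (QuotSMulTop x M) :=
      Module.free_of_flat_of_isLocalRing
    have := (Module.free_quotSMulTop_iff_free R M (maximalIdeal_le_jacobson _ hx) hxM).mp this
    exact Module.Projective.of_free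
  | succ n ih =>
    obtain ⟨F, _, _, _, _, f, hf⟩ := Module.exists_finite_presentation R M
    have hS := LinearMap.shortExact_shortComplexKer hf
    have hF := ModuleCat.projective_of_categoryTheory_projective (ModuleCat.of R F)
    refine (hS.hasProjectiveDimensionLT_X₃_iff n hF).mpr ?_
    have hxF : IsSMulRegular F x := .of_ne_zero hx0
    have hxK : IsSMulRegular (LinearMap.ker f) x :=
      fun a b hab ↦ Subtype.ext (hxF (congrArg Subtype.val hab))
    have : Module.Finite R (LinearMap.ker f) := inferInstance
    refine ih (ModuleCat.of R (LinearMap.ker f)) hxK ?_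
    let i : QuotSMulTop x (LinearMap.ker f) →ₗ[R ⧸ Ideal.span {x}] QuotSMulTop x F :=
      (QuotSMulTop.map x (LinearMap.ker f).subtype).extendScalarsOfSurjective
        Ideal.Quotient.mk_surjective
    let q : QuotSMulTop x F →ₗ[R ⧸ Ideal.span {x}] QuotSMulTop x M :=
      (QuotSMulTop.map x f).extendScalarsOfSurjective Ideal.Quotient.mk_surjective
    have hiq : Function.Exact i q := QuotSMulTop.map_exact x f.exact_subtype_ker_map hf
    have hi : Function.Injective i := by
      have h0 : Function.Exact (0 : PUnit →ₗ[R] LinearMap.ker f) (LinearMap.ker f).subtype :=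
        (LinearMap.exact_zero_iff_injective _ _).mpr Subtype.val_injective
      have := QuotSMulTop.map_first_exact_on_four_term_exact_of_isSMulRegular_last (r := x) h0
        f.exact_subtype_ker_map hxM
      rw [map_zero] at this
      exact (LinearMap.exact_zero_iff_injective _ _).mp this
    have hSx : (ModuleCat.shortComplexOfCompEqZero i q hiq.linearMap_comp_eq_zero).ShortExact :=
      { exact := (ShortComplex.ShortExact.moduleCat_exact_iff_function_exact _).mpr hiq
        mono_f := (ModuleCat.mono_iff_injective _).mpr hi
        epi_g := (ModuleCat.epi_iff_surjective _).mpr (QuotSMulTop.map_surjective x hf) }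
    have hFx : Projective (ModuleCat.of (R ⧸ Ideal.span {x}) (QuotSMulTop x F)) := by
      rw [← IsProjective.iff_projective]
      exact .of_free
    exact (hSx.hasProjectiveDimensionLT_X₃_iff n hFx).mp h

theorem IsRegularLocalRing.exists_hasProjectiveDimensionLE (R : Type u) [CommRing R]
    [IsRegularLocalRing R] (M : ModuleCat.{u} R) [Module.Finite R M] :
    ∃ n, HasProjectiveDimensionLE M n := by
  induction hd : (maximalIdeal R).spanFinrank using Nat.strong_induction_on generalizing R with
  | _ d ih =>
  by_cases h0 : maximalIdeal R = ⊥
  · refine ⟨0, ?_⟩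
    rw [← projective_iff_hasProjectiveDimensionLE_zero, ← IsProjective.iff_projective]
    exact @Module.Projective.of_free R _ M _ _ <|
      @Module.Free.of_divisionRing R M
        (isField_iff_maximalIdeal_eq.mpr h0).toField.toDivisionRing _ _
  obtain ⟨x, hx, hx2⟩ := SetLike.not_le_iff_exists.mp (maximalIdeal_not_le_sq h0)
  have := isDomain R
  have hx0 : x ≠ 0 := by
    rintro rfl
    exact hx2 (zero_mem _)
  have hreg := quotient_span_singleton hx hx2
  obtain ⟨F, _, _, _, _, f, hf⟩ := Module.exists_finite_presentation R M
  have hS := LinearMap.shortExact_shortComplexKer hf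
  have hF := ModuleCat.projective_of_categoryTheory_projective (ModuleCat.of R F)
  have hxF : IsSMulRegular F x := .of_ne_zero hx0
  have : Module.Finite (R ⧸ Ideal.span {x}) (QuotSMulTop x (LinearMap.ker f)) :=
    .of_restrictScalars_finite R _ _
  obtain ⟨n, hn⟩ := ih _ (by
    have := spanFinrank_maximalIdeal_quotient_span_singleton_add_one_le hx hx2
    lia) (R ⧸ Ideal.span {x}) (ModuleCat.of _ (QuotSMulTop x (LinearMap.ker f))) rfl
  refine ⟨n + 1, (hS.hasProjectiveDimensionLT_X₃_iff n hF).mpr ?_⟩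
  exact hasProjectiveDimensionLE_of_quotSMulTop hx hx0 n
    (ModuleCat.of R (LinearMap.ker f))
    (fun a b hab ↦ Subtype.ext (hxF (congrArg Subtype.val hab))) hn

end RegularLocal


section RegularRing

open CategoryTheory

theorem Module.exists_finite_mem_freeLocus_iff_hasProjectiveDimensionLE {A : Type u} [CommRing A]
    [IsNoetherianRing A] (n : ℕ) (M : ModuleCat.{u} A) [Module.Finite A M] :
    ∃ K : ModuleCat.{u} A, Module.Finite A K ∧ ∀ p : PrimeSpectrum A,
      p ∈ Module.freeLocus A K ↔
        HasProjectiveDimensionLE (M.localizedModule p.asIdeal.primeCompl) n := by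
  induction n generalizing M with
  | zero =>
    refine ⟨M, inferInstance, fun p ↦ ?_⟩
    rw [← projective_iff_hasProjectiveDimensionLE_zero, ← IsProjective.iff_projective,
      Module.mem_freeLocus_of_isLocalization p (Localization.AtPrime p.asIdeal)
        (M.localizedModule p.asIdeal.primeCompl) (M.localizedModuleMkLinearMap p.asIdeal.primeCompl)]
    have : Module.Finite (Localization.AtPrime p.asIdeal)
        (M.localizedModule p.asIdeal.primeCompl) :=
      .of_isLocalizedModule p.asIdeal.primeCompl
        (M.localizedModuleMkLinearMap p.asIdeal.primeCompl)
    exact ⟨fun _ ↦ .of_free, fun _ ↦ Module.free_of_flat_of_isLocalRing⟩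
  | succ n ih =>
    obtain ⟨F, _, _, _, _, f, hf⟩ := Module.exists_finite_presentation A M
    have hS := LinearMap.shortExact_shortComplexKer hf
    obtain ⟨K, hK, h⟩ := ih (ModuleCat.of A (LinearMap.ker f))
    refine ⟨K, hK, fun p ↦ (h p).trans ?_⟩
    have hSp := hS.map_of_exact (ModuleCat.localizedModuleFunctor p.asIdeal.primeCompl)
    have hF := ModuleCat.projective_of_categoryTheory_projective (ModuleCat.of A F)
    exact (hSp.hasProjectiveDimensionLT_X₃_iff n
      ((ModuleCat.localizedModuleFunctor.{u} _).projective_obj_of_projective hF)).symm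

theorem IsRegularRing.exists_hasProjectiveDimensionLE (A : Type u) [CommRing A] [IsRegularRing A]
    (M : ModuleCat.{u} A) [Module.Finite A M] : ∃ n, HasProjectiveDimensionLE M n := by
  let U (n : ℕ) : Set (PrimeSpectrum A) :=
    {p | HasProjectiveDimensionLE (M.localizedModule p.asIdeal.primeCompl) n}
  have hU (n : ℕ) : IsOpen (U n) := by
    obtain ⟨K, hK, h⟩ := Module.exists_finite_mem_freeLocus_iff_hasProjectiveDimensionLE n M
    have := Module.finitePresentation_of_finite A K
    rw [← show Module.freeLocus A K = U n from Set.ext h]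
    exact Module.isOpen_freeLocus
  have hmono : Monotone U := fun m n hmn p (hp : HasProjectiveDimensionLE _ m) ↦
    hasProjectiveDimensionLT_of_ge _ (m + 1) (n + 1) (by lia)
  have hcover : Set.univ ⊆ ⋃ n, U n := by
    intro p _
    have : Module.Finite (Localization.AtPrime p.asIdeal)
        (M.localizedModule p.asIdeal.primeCompl) :=
      .of_isLocalizedModule p.asIdeal.primeCompl
        (M.localizedModuleMkLinearMap p.asIdeal.primeCompl)
    exact Set.mem_iUnion.mpr (IsRegularLocalRing.exists_hasProjectiveDimensionLE
      (Localization.AtPrime p.asIdeal) (M.localizedModule p.asIdeal.primeCompl))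
  obtain ⟨n, hn⟩ := isCompact_univ.elim_directed_cover U hU hcover hmono.directed_le
  exact ⟨n, (M.hasProjectiveDimensionLE_iff_forall_primeSpectrum n).mpr fun p ↦ hn trivial⟩

end RegularRing


section EulerCharacteristic

variable {A : Type u} [CommRing A]

theorem K0.of_eq_add_of_exact {M' M M'' : Type u} [AddCommGroup M'] [Module A M']
    [Module.Finite A M'] [Module.Projective A M'] [AddCommGroup M] [Module A M]
    [Module.Finite A M] [Module.Projective A M] [AddCommGroup M''] [Module A M'']
    [Module.Finite A M''] [Module.Projective A M''] {f : M' →ₗ[A] M} {g : M →ₗ[A] M''}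
    (hf : Function.Injective f) (hfg : Function.Exact f g) (hg : Function.Surjective g) :
    (K0.of M : K0 A) = K0.of M' + K0.of M'' := by
  have h : (QuotientAddGroup.mk _ : K0 A) = 0 := (QuotientAddGroup.eq_zero_iff _).mpr
    (AddSubgroup.subset_closure (⟨⟨.of A M', ‹_›, ‹_›⟩, ⟨.of A M, ‹_›, ‹_›⟩,
      ⟨.of A M'', ‹_›, ‹_›⟩, f, g, hf, hg, hfg.linearMap_ker_eq.symm, rfl⟩ : _ ∈ K0Rels A))
  have h' : (K0.of M : K0 A) - K0.of M' - K0.of M'' = 0 := h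
  rwa [sub_sub, sub_eq_zero] at h'

theorem G0.mk_eq_add_of_exact {M' M M'' : FGMod A} {f : M'.1 →ₗ[A] M.1} {g : M.1 →ₗ[A] M''.1}
    (hf : Function.Injective f) (hfg : Function.Exact f g) (hg : Function.Surjective g) :
    G0.mk M = G0.mk M' + G0.mk M'' := by
  have h : (QuotientAddGroup.mk _ : G0 A) = 0 := (QuotientAddGroup.eq_zero_iff _).mpr
    (AddSubgroup.subset_closure (⟨M', M, M'', f, g, hf, hg, hfg.linearMap_ker_eq.symm, rfl⟩ :
      _ ∈ G0Rels A))
  have h' : G0.mk M - G0.mk M' - G0.mk M'' = 0 := h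
  rwa [sub_sub, sub_eq_zero] at h'

theorem K0.of_congr {M N : Type u} [AddCommGroup M] [Module A M] [Module.Finite A M]
    [Module.Projective A M] [AddCommGroup N] [Module A N] [Module.Finite A N]
    [Module.Projective A N] (e : M ≃ₗ[A] N) : (K0.of M : K0 A) = K0.of N :=
  congrArg (fun x ↦ (QuotientAddGroup.mk (FreeAbelianGroup.of x) : K0 A))
    (Quotient.sound (⟨e⟩ : Nonempty (M ≃ₗ[A] N)))

theorem K0.of_eq_zero_of_subsingleton (M : Type u) [AddCommGroup M] [Module A M]
    [Module.Finite A M] [Module.Projective A M] [Subsingleton M] : (K0.of M : K0 A) = 0 := by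
  have h := K0.of_eq_add_of_exact (A := A) (f := (0 : M →ₗ[A] M)) (g := (0 : M →ₗ[A] M))
    (Function.injective_of_subsingleton _)
    (fun _ ↦ by simp [Subsingleton.elim _ (0 : M)])
    (Function.surjective_to_subsingleton _)
  simpa using h

theorem K0.of_prod (M N : Type u) [AddCommGroup M] [Module A M] [Module.Finite A M]
    [Module.Projective A M] [AddCommGroup N] [Module A N] [Module.Finite A N]
    [Module.Projective A N] : (K0.of (M × N) : K0 A) = K0.of M + K0.of N :=
  K0.of_eq_add_of_exact LinearMap.inl_injective .inl_snd LinearMap.snd_surjective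

/-- `IsEulerChar n M c` says that `c` is the alternating sum in `K₀(A)` of the terms of some
resolution of `M` of length at most `n` by finitely generated projective modules. -/
def IsEulerChar : ℕ → ModuleCat.{u} A → K0 A → Prop
  | 0, M, c => ∃ (_ : Module.Finite A M) (_ : Module.Projective A M), c = K0.of M
  | n + 1, M, c => ∃ (P : ModuleCat.{u} A) (_ : Module.Finite A P) (_ : Module.Projective A P)
      (f : P →ₗ[A] M) (d : K0 A), Function.Surjective f ∧
        IsEulerChar n (ModuleCat.of A (LinearMap.ker f)) d ∧ c = K0.of P - d

namespace IsEulerChar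

theorem of_linearEquiv {n : ℕ} {M N : ModuleCat.{u} A} {c : K0 A} (h : IsEulerChar n M c)
    (e : M ≃ₗ[A] N) : IsEulerChar n N c := by
  cases n with
  | zero =>
    obtain ⟨_, _, rfl⟩ := h
    have : Module.Finite A N := .equiv e
    have : Module.Projective A N := .of_equiv e
    exact ⟨‹_›, ‹_›, K0.of_congr e⟩
  | succ n =>
    obtain ⟨P, hP, hP', f, d, hf, hd, rfl⟩ := h
    refine ⟨P, hP, hP', e.toLinearMap.comp f, d, e.surjective.comp hf, ?_, rfl⟩
    rwa [LinearEquiv.ker_comp]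

theorem succ {n : ℕ} {M : ModuleCat.{u} A} {c : K0 A} (h : IsEulerChar n M c) :
    IsEulerChar (n + 1) M c := by
  induction n generalizing M c with
  | zero =>
    obtain ⟨_, _, rfl⟩ := h
    have : Subsingleton (LinearMap.ker (LinearMap.id : M →ₗ[A] M)) := by
      rw [LinearMap.ker_id]
      infer_instance
    refine ⟨M, ‹_›, ‹_›, .id, 0, Function.surjective_id,
      ⟨inferInstanceAs (Module.Finite A (LinearMap.ker (LinearMap.id : M →ₗ[A] M))),
        inferInstanceAs (Module.Projective A (LinearMap.ker (LinearMap.id : M →ₗ[A] M))), ?_⟩,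
      (sub_zero _).symm⟩
    exact (K0.of_eq_zero_of_subsingleton (LinearMap.ker (LinearMap.id : M →ₗ[A] M))).symm
  | succ n ih =>
    obtain ⟨P, hP, hP', f, d, hf, hd, rfl⟩ := h
    exact ⟨P, hP, hP', f, d, hf, ih hd, rfl⟩

theorem of_le {m n : ℕ} (hmn : m ≤ n) {M : ModuleCat.{u} A} {c : K0 A} (h : IsEulerChar m M c) :
    IsEulerChar n M c :=
  Nat.le_induction h (fun _ _ ↦ succ) n hmn

theorem add_of_exact {n : ℕ} {M' M M'' : ModuleCat.{u} A} {c' c'' : K0 A}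
    (h' : IsEulerChar n M' c') (h'' : IsEulerChar n M'' c'') {f : M' →ₗ[A] M} {g : M →ₗ[A] M''}
    (hf : Function.Injective f) (hfg : Function.Exact f g) (hg : Function.Surjective g) :
    IsEulerChar n M (c' + c'') := by
  induction n generalizing M' M M'' c' c'' with
  | zero =>
    obtain ⟨_, _, rfl⟩ := h'
    obtain ⟨_, _, rfl⟩ := h''
    obtain ⟨s, hs⟩ := Module.projective_lifting_property g .id hg
    let e := (hfg.splitSurjectiveEquiv hf ⟨s, hs⟩).1
    have : Module.Finite A M := .equiv e.symm
    have : Module.Projective A M := .of_equiv e.symm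
    exact ⟨‹_›, ‹_›, (K0.of_eq_add_of_exact hf hfg hg).symm⟩
  | succ n ih =>
    obtain ⟨P', hP'f, hP'p, p', d', hp', hd', rfl⟩ := h'
    obtain ⟨P'', hP''f, hP''p, p'', d'', hp'', hd'', rfl⟩ := h''
    obtain ⟨s, hs⟩ := Module.projective_lifting_property g p'' hg
    have hs' (b) : g (s b) = p'' b := LinearMap.congr_fun hs b
    let p : (P' × P'') →ₗ[A] M := (f.comp p').coprod s
    have hgp (a b) : g (p (a, b)) = p'' b := by
      simp [p, hs', hfg.apply_apply_eq_zero]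
    have hlift (m : M) (b : P'') (hb : p'' b = g m) : ∃ a, p (a, b) = m := by
      obtain ⟨m', hm'⟩ := (hfg (m - s b)).mp (by rw [map_sub, hs', hb, sub_self])
      obtain ⟨a, rfl⟩ := hp' m'
      exact ⟨a, by simp [p, hm']⟩
    have hp : Function.Surjective p := fun m ↦ by
      obtain ⟨b, hb⟩ := hp'' (g m)
      obtain ⟨a, ha⟩ := hlift m b hb
      exact ⟨_, ha⟩
    let i : LinearMap.ker p' →ₗ[A] LinearMap.ker p :=
      (LinearMap.inl A P' P'').restrict fun a ha ↦ by
        simp [p, LinearMap.mem_ker.mp ha]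
    let q : LinearMap.ker p →ₗ[A] LinearMap.ker p'' :=
      (LinearMap.snd A P' P'').restrict fun x hx ↦ by
        rw [LinearMap.mem_ker, LinearMap.snd_apply, ← hgp x.1 x.2, LinearMap.mem_ker.mp hx,
          map_zero]
    have hi : Function.Injective i := fun a b hab ↦
      Subtype.ext (LinearMap.inl_injective (congrArg Subtype.val hab))
    have hiq : Function.Exact i q := by
      rintro ⟨⟨a, b⟩, hx⟩
      constructor
      · intro h
        obtain rfl : b = 0 := congrArg Subtype.val h
        refine ⟨⟨a, hf ?_⟩, rfl⟩
        simpa [p] using hx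
      · rintro ⟨a, ha⟩
        exact Subtype.ext (congrArg (fun z ↦ z.1.2) ha).symm
    have hq : Function.Surjective q := by
      rintro ⟨b, hb⟩
      obtain ⟨a, ha⟩ := hlift 0 b (by rw [map_zero, LinearMap.mem_ker.mp hb])
      exact ⟨⟨(a, b), ha⟩, rfl⟩
    refine ⟨.of A (P' × P''), inferInstanceAs (Module.Finite A (P' × P'')),
      inferInstanceAs (Module.Projective A (P' × P'')), p, d' + d'', hp,
      ih hd' hd'' hi hiq hq, ?_⟩
    rw [sub_add_sub_comm]
    exact congrArg (· - (d' + d'')) (K0.of_prod P' P'').symm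

theorem unique_of_same_length {n : ℕ} {M : ModuleCat.{u} A} {c d : K0 A} (hc : IsEulerChar n M c)
    (hd : IsEulerChar n M d) : c = d := by
  induction n generalizing M c d with
  | zero =>
    obtain ⟨_, _, rfl⟩ := hc
    obtain ⟨_, _, rfl⟩ := hd
    rfl
  | succ n ih =>
    obtain ⟨P, hPf, hPp, p, c, hp, hc, rfl⟩ := hc
    obtain ⟨Q, hQf, hQp, q, d, hq, hd, rfl⟩ := hd
    let X := LinearMap.ker (p.coprod (-q))
    have hX (x : P × Q) : x ∈ X ↔ p x.1 = q x.2 := by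
      simp [X, ← sub_eq_add_neg, sub_eq_zero]
    have h₁ : IsEulerChar n (.of A X) (d + K0.of P) := by
      refine add_of_exact hd (of_le (Nat.zero_le n) ⟨hPf, hPp, rfl⟩)
        (f := LinearMap.codRestrict X (LinearMap.inr A P Q ∘ₗ (LinearMap.ker q).subtype)
          fun b ↦ (hX _).mpr ?_)
        (g := LinearMap.fst A P Q ∘ₗ X.subtype) ?_ ?_ ?_
      · simp
      · intro a b hab
        exact Subtype.ext (LinearMap.inr_injective (congrArg Subtype.val hab))
      · rintro ⟨⟨a, b⟩, hx⟩
        constructor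
        · intro h
          obtain rfl : a = 0 := h
          refine ⟨⟨b, ?_⟩, rfl⟩
          simpa using ((hX _).mp hx).symm
        · rintro ⟨b, hb⟩
          exact (congrArg (fun z ↦ z.1.1) hb).symm
      · intro a
        obtain ⟨b, hb⟩ := hq (p a)
        exact ⟨⟨(a, b), (hX _).mpr hb.symm⟩, rfl⟩
    have h₂ : IsEulerChar n (.of A X) (c + K0.of Q) := by
      refine add_of_exact hc (of_le (Nat.zero_le n) ⟨hQf, hQp, rfl⟩)
        (f := LinearMap.codRestrict X (LinearMap.inl A P Q ∘ₗ (LinearMap.ker p).subtype)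
          fun b ↦ (hX _).mpr ?_)
        (g := LinearMap.snd A P Q ∘ₗ X.subtype) ?_ ?_ ?_
      · simp
      · intro a b hab
        exact Subtype.ext (LinearMap.inl_injective (congrArg Subtype.val hab))
      · rintro ⟨⟨a, b⟩, hx⟩
        constructor
        · intro h
          obtain rfl : b = 0 := h
          refine ⟨⟨a, ?_⟩, rfl⟩
          simpa using (hX _).mp hx
        · rintro ⟨b, hb⟩
          exact (congrArg (fun z ↦ z.1.2) hb).symm
      · intro b
        obtain ⟨a, ha⟩ := hp (q b)
        exact ⟨⟨(a, b), (hX _).mpr ha⟩, rfl⟩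
    have h := ih h₁ h₂
    rw [sub_eq_sub_iff_add_eq_add, add_comm, h, add_comm]

theorem unique {m n : ℕ} {M : ModuleCat.{u} A} {c d : K0 A} (hc : IsEulerChar m M c)
    (hd : IsEulerChar n M d) : c = d :=
  unique_of_same_length (of_le (le_max_left m n) hc) (of_le (le_max_right m n) hd)

open CategoryTheory in
theorem exists_of_hasProjectiveDimensionLE [IsNoetherianRing A] (n : ℕ) (M : ModuleCat.{u} A)
    [Module.Finite A M] (h : HasProjectiveDimensionLE M n) : ∃ c, IsEulerChar n M c := by
  induction n generalizing M with
  | zero =>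
    rw [← projective_iff_hasProjectiveDimensionLE_zero, ← IsProjective.iff_projective] at h
    exact ⟨_, ‹_›, h, rfl⟩
  | succ n ih =>
    obtain ⟨F, _, _, _, _, f, hf⟩ := Module.exists_finite_presentation A M
    have hF := ModuleCat.projective_of_categoryTheory_projective (ModuleCat.of A F)
    obtain ⟨d, hd⟩ := ih (ModuleCat.of A (LinearMap.ker f))
      (((LinearMap.shortExact_shortComplexKer hf).hasProjectiveDimensionLT_X₃_iff n hF).mp h)
    exact ⟨_, .of A F, ‹_›, inferInstanceAs (Module.Projective A F), f, d, hf, hd, rfl⟩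

end IsEulerChar

/-- The natural homomorphism `K₀(A) → G₀(A)`. -/
noncomputable def K0.toG0 (A : Type u) [CommRing A] : K0 A →+ G0 A :=
  QuotientAddGroup.lift (AddSubgroup.closure (K0Rels A))
    (FreeAbelianGroup.lift (Quotient.lift (fun P : FGProj A ↦ G0.mk ⟨P.1, P.2.1⟩)
      fun _ _ e ↦ congrArg (fun x ↦ (QuotientAddGroup.mk (FreeAbelianGroup.of x) : G0 A))
        (Quotient.sound e)))
    ((AddSubgroup.closure_le _).mpr <| by
      rintro _ ⟨M', M, M'', f, g, hf, hg, hfg, rfl⟩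
      simp only [SetLike.mem_coe, AddMonoidHom.mem_ker, map_sub, FreeAbelianGroup.lift_apply_of]
      rw [sub_sub, sub_eq_zero]
      exact G0.mk_eq_add_of_exact hf (LinearMap.exact_iff.mpr hfg.symm) hg)

theorem K0.toG0_mk (P : FGProj A) : K0.toG0 A (K0.mk P) = G0.mk ⟨P.1, P.2.1⟩ :=
  FreeAbelianGroup.lift_apply_of _ _

theorem K0.hom_ext {G : Type*} [AddCommGroup G] {f g : K0 A →+ G}
    (h : ∀ P, f (K0.mk P) = g (K0.mk P)) : f = g :=
  QuotientAddGroup.addMonoidHom_ext _ (FreeAbelianGroup.lift_ext _ _ fun x ↦ by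
    obtain ⟨P, rfl⟩ := Quotient.exists_rep x
    exact h P)

theorem G0.hom_ext {G : Type*} [AddCommGroup G] {f g : G0 A →+ G}
    (h : ∀ M, f (G0.mk M) = g (G0.mk M)) : f = g :=
  QuotientAddGroup.addMonoidHom_ext _ (FreeAbelianGroup.lift_ext _ _ fun x ↦ by
    obtain ⟨M, rfl⟩ := Quotient.exists_rep x
    exact h M)

theorem IsEulerChar.toG0_eq [IsNoetherianRing A] {n : ℕ} {M : ModuleCat.{u} A} {c : K0 A}
    (h : IsEulerChar n M c) (hM : Module.Finite A M) : K0.toG0 A c = G0.mk ⟨M, hM⟩ := by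
  induction n generalizing M c with
  | zero =>
    obtain ⟨_, _, rfl⟩ := h
    exact K0.toG0_mk _
  | succ n ih =>
    obtain ⟨P, hP, hP', f, d, hf, hd, rfl⟩ := h
    rw [map_sub, ih hd (inferInstanceAs (Module.Finite A (LinearMap.ker f))), sub_eq_iff_eq_add']
    exact (K0.toG0_mk _).trans
      (G0.mk_eq_add_of_exact (M' := ⟨.of A (LinearMap.ker f), _⟩) (M := ⟨P, hP⟩) (M'' := ⟨M, hM⟩)
        (LinearMap.ker f).injective_subtype f.exact_subtype_ker_map hf)

/-- The Euler characteristic `G₀(A) → K₀(A)`, for a ring over which all finitely generated modules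
have finite resolutions by finitely generated projective modules. -/
noncomputable def G0.eulerChar (h : ∀ M : FGMod A, ∃ n c, IsEulerChar n M.1 c) : G0 A →+ K0 A :=
  QuotientAddGroup.lift (AddSubgroup.closure (G0Rels A))
    (FreeAbelianGroup.lift (Quotient.lift (fun M : FGMod A ↦ (h M).choose_spec.choose)
      fun M N ⟨e⟩ ↦ ((h M).choose_spec.choose_spec.of_linearEquiv e).unique
        (h N).choose_spec.choose_spec))
    ((AddSubgroup.closure_le _).mpr <| by
      rintro _ ⟨M', M, M'', f, g, hf, hg, hfg, rfl⟩
      simp only [SetLike.mem_coe, AddMonoidHom.mem_ker, map_sub, FreeAbelianGroup.lift_apply_of]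
      rw [sub_sub, sub_eq_zero]
      exact (h M).choose_spec.choose_spec.unique
        (((h M').choose_spec.choose_spec.of_le (le_max_left _ _)).add_of_exact
          ((h M'').choose_spec.choose_spec.of_le (le_max_right _ _)) hf
          (LinearMap.exact_iff.mpr hfg.symm) hg))

theorem G0.eulerChar_mk (h : ∀ M : FGMod A, ∃ n c, IsEulerChar n M.1 c) (M : FGMod A) {n : ℕ}
    {c : K0 A} (hc : IsEulerChar n M.1 c) : G0.eulerChar h (G0.mk M) = c :=
  (FreeAbelianGroup.lift_apply_of _ _).trans ((h M).choose_spec.choose_spec.unique hc)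

end EulerCharacteristic


/-- **Dévissage for regular rings.** If `A` is a commutative
noetherian ring all of whose localizations at primes are regular local rings,
then the natural homomorphism `K₀(A) → G₀(A)`, sending the class of a finitely
generated projective module to its class as a finitely generated module, is an
isomorphism: there is a group isomorphism `K₀(A) ≃ G₀(A)` acting in this way on
generators (it is unique since the generators generate). -/
theorem K0_equiv_G0_of_regular (A : Type u) [CommRing A] [IsNoetherianRing A]
    (hreg : ∀ (𝔭 : Ideal A) (_ : 𝔭.IsPrime), IsRegularLocal (Localization.AtPrime 𝔭)) :
    ∃ φ : K0 A ≃+ G0 A, ∀ P : FGProj A, φ (K0.mk P) = G0.mk ⟨P.1, P.2.1⟩ := by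
  have : IsRegularRing A := isRegularRing_iff.mpr fun 𝔭 h𝔭 ↦ by
    have := (hreg 𝔭 h𝔭).1
    exact (IsRegularLocalRing.iff_finrank_cotangentSpace _).mpr (hreg 𝔭 h𝔭).2.symm
  have h (M : FGMod A) : ∃ n c, IsEulerChar n M.1 c := by
    have := M.2
    obtain ⟨n, hn⟩ := IsRegularRing.exists_hasProjectiveDimensionLE A M.1
    exact ⟨n, IsEulerChar.exists_of_hasProjectiveDimensionLE n M.1 hn⟩
  refine ⟨(K0.toG0 A).toAddEquiv (G0.eulerChar h) (K0.hom_ext fun P ↦ ?_)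
    (G0.hom_ext fun M ↦ ?_), K0.toG0_mk⟩
  · rw [AddMonoidHom.comp_apply, K0.toG0_mk]
    exact G0.eulerChar_mk h ⟨P.1, P.2.1⟩ (n := 0) ⟨P.2.1, P.2.2, rfl⟩
  · obtain ⟨n, c, hc⟩ := h M
    rw [AddMonoidHom.comp_apply, G0.eulerChar_mk h M hc]
    exact hc.toG0_eq M.2
end

section
/- Let A be a commutative regular local ring (in particular noetherian). Then the Grothendieck group G₀(A) of finitely generated A-modules is infinite cyclic, generated by the class [A] of the free module of rank one; equivalently, there is a group isomorphism G₀(A) ≅ ℤ sending [A] to 1. -/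
universe u

variable (R : Type u) [CommRing R]

open IsLocalRing

/-- `R`-modules all of whose `n`-th syzygies, computed with finite free covers, are free. -/
def HasFreeSyzygy (R : Type u) [CommRing R] :
    ℕ → ∀ (M : Type u) [AddCommGroup M] [Module R M], Prop
  | 0, M, _, _ => Module.Free R M
  | n + 1, M, _, _ => ∀ (k : ℕ) (f : (Fin k → R) →ₗ[R] M), Function.Surjective f →
      HasFreeSyzygy R n (LinearMap.ker f)

open Pointwise in
/-- Free syzygies lift along reduction modulo a regular element of the maximal ideal. -/
theorem HasFreeSyzygy.of_quotient_span_singleton {R : Type u} [CommRing R] [IsLocalRing R]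
    [IsNoetherianRing R] {x : R} (hx : x ∈ maximalIdeal R) (hxR : IsSMulRegular R x) (n : ℕ)
    {M : Type u} [AddCommGroup M] [Module R M] [Module.Finite R M] (hxM : IsSMulRegular M x)
    {N : Type u} [AddCommGroup N] [Module R N] [Module (R ⧸ Ideal.span {x}) N]
    [IsScalarTower R (R ⧸ Ideal.span {x}) N]
    (p : M →ₗ[R] N) (hp : Function.Surjective p) (hker : ∀ m, p m = 0 ↔ ∃ m', m = x • m')
    (hN : HasFreeSyzygy (R ⧸ Ideal.span {x}) n N) : HasFreeSyzygy R n M := by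
  induction n generalizing M N with
  | zero =>
    have hmem : x ∈ (⊥ : Ideal R).jacobson := by
      rwa [IsLocalRing.jacobson_eq_maximalIdeal _ bot_ne_top]
    have hker' : x • (⊤ : Submodule R M) = LinearMap.ker p := by
      ext m
      simp [Submodule.mem_smul_pointwise_iff_exists, hker, eq_comm]
    let e : QuotSMulTop x M ≃ₗ[R] N :=
      (Submodule.quotEquivOfEq _ _ hker').trans (p.quotKerEquivOfSurjective hp)
    have hfree : Module.Free (R ⧸ Ideal.span {x}) N := hN
    have hfree' := Module.Free.of_equiv (e.extendScalarsOfSurjective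
      (Ideal.Quotient.mk_surjective (I := Ideal.span {x}))).symm
    have := Module.finitePresentation_of_finite R M
    exact (Module.free_quotSMulTop_iff_free R M hmem hxM).mp hfree'
  | succ n ih =>
    intro k f hf
    let S := R ⧸ Ideal.span {x}
    let g : (Fin k → S) →ₗ[S] N :=
      Fintype.linearCombination S fun i => p (f (Pi.single i 1))
    let q : (Fin k → R) →ₗ[R] (Fin k → S) := (Algebra.linearMap R S).compLeft (Fin k)
    have hq : Function.Surjective q := fun s => by
      choose r hr using fun i => Ideal.Quotient.mk_surjective (s i)
      exact ⟨r, funext hr⟩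
    have hqk (r) (h : q r = 0) : ∃ r', r = x • r' := by
      have h' (i) : ∃ c, r i = x * c := by
        have : Ideal.Quotient.mk (Ideal.span {x}) (r i) = 0 := congrFun h i
        rwa [Ideal.Quotient.eq_zero_iff_mem, Ideal.mem_span_singleton] at this
      choose c hc using h'
      exact ⟨c, funext hc⟩
    have hqx (r) : q (x • r) = 0 := by
      ext i
      have : Ideal.Quotient.mk (Ideal.span {x}) (x * r i) = 0 := by
        rw [Ideal.Quotient.eq_zero_iff_mem, Ideal.mem_span_singleton]
        exact dvd_mul_right _ _
      exact this
    have hgq (r) : g (q r) = p (f r) := by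
      have : (g.restrictScalars R).comp q = p.comp f := by
        ext i
        have : q (Pi.single i 1) = Pi.single i 1 := by
          ext j
          by_cases h : j = i
          · subst h; simp [q]
          · simp [q, h]
        simp [g, this]
      exact LinearMap.congr_fun this r
    have hg : Function.Surjective g := fun y => by
      obtain ⟨m, rfl⟩ := hp y
      obtain ⟨r, rfl⟩ := hf m
      exact ⟨q r, hgq r⟩
    let p' : LinearMap.ker f →ₗ[R] LinearMap.ker g :=
      { toFun := fun r => ⟨q r, by
          rw [LinearMap.mem_ker, hgq, LinearMap.mem_ker.mp r.2, map_zero]⟩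
        map_add' := fun a b => Subtype.ext (map_add q _ _)
        map_smul' := fun a b => Subtype.ext (map_smul q _ _) }
    have hxF : IsSMulRegular (Fin k → R) x := IsSMulRegular.pi fun _ => hxR
    refine ih (M := LinearMap.ker f) (N := LinearMap.ker g) ?_ p' ?_ ?_ (hN k g hg)
    · intro a b h
      exact Subtype.ext (hxF (congrArg Subtype.val h))
    · rintro ⟨s, hs⟩
      obtain ⟨r, rfl⟩ := hq s
      rw [LinearMap.mem_ker, hgq, hker] at hs
      obtain ⟨m, hm⟩ := hs
      obtain ⟨t, rfl⟩ := hf m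
      refine ⟨⟨r - x • t, by simp [hm]⟩, Subtype.ext ?_⟩
      change q (r - x • t) = q r
      rw [map_sub, hqx, sub_zero]
    · rintro ⟨r, hr⟩
      constructor
      · intro h
        obtain ⟨t, rfl⟩ := hqk r (congrArg Subtype.val h)
        refine ⟨⟨t, ?_⟩, rfl⟩
        rw [LinearMap.mem_ker] at hr ⊢
        rw [map_smul] at hr
        exact hxM.right_eq_zero_of_smul hr
      · rintro ⟨t, ht⟩
        have : r = x • t.1 := congrArg Subtype.val ht
        exact Subtype.ext ((congrArg q this).trans (hqx _))

open Pointwise in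
/-- If all modules over `R ⧸ (x)` have free `n`-th syzygies, for a regular element `x` of the
maximal ideal, then all modules over `R` have free `(n + 1)`-st syzygies. -/
theorem HasFreeSyzygy.succ_of_quotient_span_singleton {R : Type u} [CommRing R] [IsLocalRing R]
    [IsNoetherianRing R] {x : R} (hx : x ∈ maximalIdeal R) (hxR : IsSMulRegular R x) (n : ℕ)
    (h : ∀ (N : Type u) [AddCommGroup N] [Module (R ⧸ Ideal.span {x}) N]
      [Module.Finite (R ⧸ Ideal.span {x}) N], HasFreeSyzygy (R ⧸ Ideal.span {x}) n N)
    (M : Type u) [AddCommGroup M] [Module R M] : HasFreeSyzygy R (n + 1) M := by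
  intro k f _
  have hxF : IsSMulRegular (Fin k → R) x := IsSMulRegular.pi fun _ => hxR
  have := Module.Finite.of_restrictScalars_finite R (R ⧸ Ideal.span {x})
    (QuotSMulTop x (LinearMap.ker f))
  refine of_quotient_span_singleton hx hxR n
    (fun a b h => Subtype.ext (hxF (congrArg Subtype.val h)))
    (Submodule.mkQ (x • (⊤ : Submodule R (LinearMap.ker f)))) (Submodule.mkQ_surjective _) ?_
    (h (QuotSMulTop x (LinearMap.ker f)))
  intro m
  rw [← LinearMap.mem_ker, Submodule.ker_mkQ, Submodule.mem_smul_pointwise_iff_exists]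
  simp [eq_comm]

/-- A quotient of a regular local ring by an element of the maximal ideal outside its square needs
fewer generators for its maximal ideal. -/
theorem IsLocalRing.spanFinrank_maximalIdeal_quotient_add_one_le {R : Type u} [CommRing R]
    [IsLocalRing R] [IsNoetherianRing R] {x : R} (hx : x ∈ maximalIdeal R)
    (hx2 : x ∉ maximalIdeal R ^ 2) [IsLocalRing (R ⧸ Ideal.span {x})] :
    (maximalIdeal (R ⧸ Ideal.span {x})).spanFinrank + 1 ≤ (maximalIdeal R).spanFinrank := by
  classical
  let v : CotangentSpace R := (maximalIdeal R).toCotangent ⟨x, hx⟩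
  have hv : v ≠ 0 := fun h => hx2 (((maximalIdeal R).toCotangent_eq_zero _).mp h)
  obtain ⟨b, -, hvb, hb, hli⟩ := exists_linearIndepOn_id_extension
    (K := ResidueField R) (LinearIndepOn.singleton (v := id) hv) (Set.subset_univ {v})
  have hvb : v ∈ b := hvb rfl
  have hfin : b.Finite := hli.setFinite
  have hcard : b.ncard ≤ (maximalIdeal R).spanFinrank := by
    rw [spanFinrank_maximalIdeal_eq_finrank_cotangentSpace]
    have := hfin.fintype
    rw [Set.ncard_eq_toFinset_card']
    simpa using LinearIndependent.fintype_card_le_finrank hli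
  obtain ⟨g, hg⟩ := (maximalIdeal R).toCotangent_surjective.hasRightInverse
  let s : Set (maximalIdeal R) := g '' (b \ {v})
  have hs : (maximalIdeal R).toCotangent '' insert ⟨x, hx⟩ s = b := by
    rw [Set.image_insert_eq, Set.image_image]
    simp only [hg _, Set.image_id']
    exact Set.insert_sdiff_self_of_mem hvb
  have hspan : Submodule.span R (insert ⟨x, hx⟩ s) = ⊤ := by
    rw [← CotangentSpace.span_image_eq_top_iff, hs]
    exact top_le_iff.mp fun y _ => hb (Set.mem_univ y)
  have hspan' : Ideal.span (insert x (Subtype.val '' s)) = maximalIdeal R := by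
    have := congrArg (Submodule.map (maximalIdeal R).subtype) hspan
    rw [Submodule.map_span, Set.image_insert_eq, Submodule.map_top, Submodule.range_subtype] at this
    exact this
  have hmax : maximalIdeal (R ⧸ Ideal.span {x}) =
      Ideal.span (Ideal.Quotient.mk (Ideal.span {x}) '' (Subtype.val '' s)) := by
    rw [← IsLocalRing.map_maximalIdeal_of_surjective _ Ideal.Quotient.mk_surjective]
    refine (congrArg (Ideal.map _) hspan'.symm).trans ?_
    rw [Ideal.map_span, Set.image_insert_eq, Ideal.Quotient.eq_zero_iff_mem.mpr
        (Ideal.mem_span_singleton_self x), Ideal.span_insert_zero]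
  have hsfin : s.Finite := (hfin.subset Set.sdiff_subset).image _
  have hle : (maximalIdeal (R ⧸ Ideal.span {x})).spanFinrank ≤ (b \ {v}).ncard := by
    rw [hmax]
    refine (Submodule.spanFinrank_span_le_ncard_of_finite ((hsfin.image _).image _)).trans ?_
    refine (Set.ncard_image_le (hsfin.image _)).trans ?_
    exact (Set.ncard_image_le hsfin).trans (Set.ncard_image_le (hfin.subset Set.sdiff_subset))
  have := Set.ncard_sdiff_singleton_add_one hvb hfin
  lia

/-- A regular local ring of dimension `n` is a domain over which `n`-th syzygies are free. -/
theorem IsRegularLocalRing.isDomain_and_hasFreeSyzygy (n : ℕ) {R : Type u} [CommRing R]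
    [IsRegularLocalRing R] (hn : (maximalIdeal R).spanFinrank = n) :
    IsDomain R ∧ ∀ (M : Type u) [AddCommGroup M] [Module R M] [Module.Finite R M],
      HasFreeSyzygy R n M := by
  induction n generalizing R with
  | zero =>
    rw [Submodule.spanFinrank_eq_zero_iff_eq_bot (maximalIdeal R).fg_of_isNoetherianRing,
      ← isField_iff_maximalIdeal_eq] at hn
    let := hn.toField
    exact ⟨inferInstance, fun M _ _ _ => Module.Free.of_divisionRing R M⟩
  | succ n ih =>
    have hdim : ringKrullDim R = (n + 1 : ℕ) := by
      rw [← hn]; exact ((isRegularLocalRing_iff R).mp inferInstance).symm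
    have hmin : maximalIdeal R ∉ minimalPrimes R := by
      rw [← Ideal.height_eq_zero_iff]
      intro h
      have := maximalIdeal_height_eq_ringKrullDim (R := R)
      rw [h, hdim] at this
      norm_cast at this
    have hsq : ¬ maximalIdeal R ≤ maximalIdeal R ^ 2 := by
      intro h
      have := Submodule.eq_bot_of_le_smul_of_le_jacobson_bot (maximalIdeal R) (maximalIdeal R)
        (IsNoetherian.noetherian _) (by rwa [smul_eq_mul, ← pow_two])
        (jacobson_eq_maximalIdeal _ bot_ne_top).ge
      rw [this, Submodule.spanFinrank_bot] at hn
      lia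
    obtain ⟨x, hx, hx2, hxmin⟩ : ∃ x ∈ maximalIdeal R, x ∉ maximalIdeal R ^ 2 ∧
        ∀ p ∈ minimalPrimes R, x ∉ p := by
      classical
      by_contra! hcon
      let s : Finset (Ideal R) :=
        insert (maximalIdeal R ^ 2) (minimalPrimes.finite_of_isNoetherianRing R).toFinset
      have := (Ideal.subset_union_prime (s := s) (f := id) (I := maximalIdeal R)
        (maximalIdeal R ^ 2) (maximalIdeal R ^ 2) (fun p hp hne _ => by
          rcases Finset.mem_insert.mp hp with h | h
          · exact absurd h hne
          · exact Ideal.IsMinimalPrime.isPrime (I := ⊥) (by simpa using h))).mp (fun x hx => by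
            by_cases h : x ∈ maximalIdeal R ^ 2
            · simpa [s] using Or.inl h
            · simpa [s] using Or.inr (hcon x hx h))
      obtain ⟨p, hp, hle⟩ := this
      rcases Finset.mem_insert.mp hp with h | h
      · exact hsq (h ▸ hle)
      · have hp : p ∈ minimalPrimes R := by simpa using h
        have := Ideal.IsMinimalPrime.isPrime hp
        rw [← (maximalIdeal.isMaximal R).eq_of_le this.ne_top hle] at hp
        exact hmin hp
    have hne : Ideal.span {x} ≠ ⊤ :=
      ne_top_of_le_ne_top (maximalIdeal.isMaximal R).ne_top (by simpa [Ideal.span_le] using hx)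
    have : Nontrivial (R ⧸ Ideal.span {x}) := Ideal.Quotient.nontrivial_iff.mpr hne
    have : IsLocalRing (R ⧸ Ideal.span {x}) :=
      .of_surjective' _ Ideal.Quotient.mk_surjective
    have hgen := spanFinrank_maximalIdeal_quotient_add_one_le hx hx2
    have hle := Ideal.height_le_ringKrullDim_quotient_add_one hx
    rw [maximalIdeal_height_eq_ringKrullDim, hdim] at hle
    have hle' : (n : WithBot ℕ∞) ≤ ringKrullDim (R ⧸ Ideal.span {x}) := by
      have h0 : 0 ≤ ringKrullDim (R ⧸ Ideal.span {x}) := ringKrullDim_nonneg_of_nontrivial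
      have h1 := ringKrullDim_le_spanFinrank_maximalIdeal (R ⧸ Ideal.span {x})
      generalize ringKrullDim (R ⧸ Ideal.span {x}) = d at *
      induction d with
      | bot => simp at h0
      | coe d =>
        induction d with
        | top => exact le_top
        | coe d => norm_cast at hle ⊢; lia
    have hup := ringKrullDim_le_spanFinrank_maximalIdeal (R ⧸ Ideal.span {x})
    have heq : (maximalIdeal (R ⧸ Ideal.span {x})).spanFinrank = n := by
      have := hle'.trans hup
      norm_cast at this
      lia
    have := of_spanFinrank_maximalIdeal_le (R ⧸ Ideal.span {x}) (by rwa [heq])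
    obtain ⟨hdom, hfree⟩ := ih heq
    have hprime : (Ideal.span {x}).IsPrime := (Ideal.Quotient.isDomain_iff_prime _).mp hdom
    obtain ⟨p, hp, hpx⟩ := Ideal.exists_minimalPrimes_le (bot_le : ⊥ ≤ Ideal.span {x})
    have hpp := Ideal.IsMinimalPrime.isPrime hp
    have hbot : p = ⊥ := by
      refine Submodule.eq_bot_of_le_smul_of_le_jacobson_bot (maximalIdeal R) p
        (IsNoetherian.noetherian _) (fun y hy => ?_) (jacobson_eq_maximalIdeal _ bot_ne_top).ge
      obtain ⟨z, rfl⟩ := Ideal.mem_span_singleton.mp (hpx hy)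
      exact Submodule.smul_mem_smul hx ((hpp.mem_or_mem hy).resolve_left (hxmin p hp))
    have : (⊥ : Ideal R).IsPrime := hbot ▸ hpp
    have := IsDomain.of_bot_isPrime R
    have hx0 : x ≠ 0 := fun h => hx2 (h ▸ zero_mem _)
    exact ⟨this, fun M _ _ _ => HasFreeSyzygy.succ_of_quotient_span_singleton hx
      (.of_ne_zero hx0) n hfree M⟩

namespace G0

variable {A : Type u} [CommRing A]

/-- The class in `G₀` is additive on short exact sequences. -/
theorem of_eq_add {M' M M'' : Type u} [AddCommGroup M'] [Module A M'] [Module.Finite A M']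
    [AddCommGroup M] [Module A M] [Module.Finite A M]
    [AddCommGroup M''] [Module A M''] [Module.Finite A M'']
    (f : M' →ₗ[A] M) (g : M →ₗ[A] M'') (hf : Function.Injective f)
    (hg : Function.Surjective g) (hfg : LinearMap.range f = LinearMap.ker g) :
    (G0.of M : G0 A) = G0.of M' + G0.of M'' := by
  have h : FreeAbelianGroup.of (⟦⟨ModuleCat.of A M, ‹_›⟩⟧ : Quotient (FGMod.setoid A)) -
      FreeAbelianGroup.of ⟦⟨ModuleCat.of A M', ‹_›⟩⟧ -
      FreeAbelianGroup.of ⟦⟨ModuleCat.of A M'', ‹_›⟩⟧ ∈ AddSubgroup.closure (G0Rels A) :=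
    AddSubgroup.subset_closure ⟨_, _, _, f, g, hf, hg, hfg, rfl⟩
  have h' := (QuotientAddGroup.eq_zero_iff _).mpr h
  have h'' : (G0.of M : G0 A) - G0.of M' - G0.of M'' = 0 := h'
  rw [sub_sub, sub_eq_zero] at h''
  exact h''

theorem of_eq_of_linearEquiv {M N : Type u} [AddCommGroup M] [Module A M] [Module.Finite A M]
    [AddCommGroup N] [Module A N] [Module.Finite A N] (e : M ≃ₗ[A] N) :
    (G0.of M : G0 A) = G0.of N := by
  have : (⟦⟨ModuleCat.of A M, ‹_›⟩⟧ : Quotient (FGMod.setoid A)) =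
      ⟦⟨ModuleCat.of A N, ‹_›⟩⟧ := Quotient.sound ⟨e⟩
  exact congrArg (fun q => (QuotientAddGroup.mk (FreeAbelianGroup.of q) : G0 A)) this

theorem of_prod (M N : Type u) [AddCommGroup M] [Module A M] [Module.Finite A M]
    [AddCommGroup N] [Module A N] [Module.Finite A N] :
    (G0.of (M × N) : G0 A) = G0.of M + G0.of N :=
  of_eq_add (LinearMap.inl A M N) (LinearMap.snd A M N) LinearMap.inl_injective
    LinearMap.snd_surjective (LinearMap.range_inl A M N)

theorem of_eq_zero_of_subsingleton (M : Type u) [AddCommGroup M] [Module A M] [Module.Finite A M]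
    [Subsingleton M] : (G0.of M : G0 A) = 0 := by
  have := of_eq_add (A := A) (0 : M →ₗ[A] M) (0 : M →ₗ[A] M)
    (Function.injective_of_subsingleton _) (Function.surjective_to_subsingleton _)
    (Subsingleton.elim _ _)
  simpa using this

theorem of_fin_fun (k : ℕ) : (G0.of (Fin k → A) : G0 A) = k • G0.of A := by
  induction k with
  | zero => simpa using of_eq_zero_of_subsingleton (A := A) (Fin 0 → A)
  | succ k ih =>
    rw [← of_eq_of_linearEquiv (Fin.consLinearEquiv A fun _ : Fin (k + 1) => A), of_prod, ih,
      succ_nsmul, add_comm]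

/-- A module with free `n`-th syzygies has class in the subgroup generated by the class of the
ring. -/
theorem of_mem_zmultiples [IsNoetherianRing A] [Nontrivial A] (n : ℕ) (M : Type u)
    [AddCommGroup M] [Module A M] [Module.Finite A M] (hM : HasFreeSyzygy A n M) :
    (G0.of M : G0 A) ∈ AddSubgroup.zmultiples (G0.of A : G0 A) := by
  induction n generalizing M with
  | zero =>
    have : Module.Free A M := hM
    rw [of_eq_of_linearEquiv (Module.finBasis A M).equivFun, of_fin_fun]
    exact nsmul_mem (AddSubgroup.mem_zmultiples _) _
  | succ n ih =>
    obtain ⟨k, f, hf⟩ := Module.Finite.exists_fin' A M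
    have h := of_eq_add (LinearMap.ker f).subtype f Subtype.val_injective hf
      (Submodule.range_subtype _)
    rw [← sub_eq_iff_eq_add', of_fin_fun] at h
    rw [← h]
    exact sub_mem (nsmul_mem (AddSubgroup.mem_zmultiples _) _) (ih _ (hM k f hf))

/-- The rank homomorphism on `G₀` of a domain. -/
noncomputable def rank (A : Type u) [CommRing A] [IsDomain A] : G0 A →+ ℤ :=
  QuotientAddGroup.lift _
    (FreeAbelianGroup.lift (Quotient.lift (fun M : FGMod A => (Module.finrank A M.1 : ℤ))
      fun _ _ ⟨e⟩ => congrArg Nat.cast e.finrank_eq)) <| by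
    rw [AddSubgroup.closure_le]
    rintro _ ⟨M', M, M'', f, g, hf, hg, hfg, rfl⟩
    have := M.2
    have h := Submodule.finrank_quotient_add_finrank (LinearMap.ker g)
    rw [(g.quotKerEquivOfSurjective hg).finrank_eq, ← hfg, LinearMap.finrank_range_of_inj hf] at h
    simp [← h]

theorem rank_of_self [IsDomain A] : rank A (G0.of A) = 1 := by
  have : rank A (G0.of A) = (Module.finrank A A : ℤ) :=
    FreeAbelianGroup.lift_apply_of _ _
  simpa using this

/-- If every class of a module is a multiple of the class of the ring, so is every element. -/
theorem zmultiples_of_self_eq_top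
    (h : ∀ (M : Type u) [AddCommGroup M] [Module A M] [Module.Finite A M],
      (G0.of M : G0 A) ∈ AddSubgroup.zmultiples (G0.of A : G0 A)) :
    AddSubgroup.zmultiples (G0.of A : G0 A) = ⊤ := by
  refine (AddSubgroup.eq_top_iff' _).mpr fun y => ?_
  obtain ⟨y, rfl⟩ := QuotientAddGroup.mk_surjective y
  induction y using FreeAbelianGroup.induction_on with
  | zero => exact zero_mem _
  | of q =>
    obtain ⟨M, hM⟩ := q
    exact h M
  | neg q ih => exact neg_mem ih
  | add a b ha hb => exact add_mem ha hb

end G0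

/-- If `A` is a commutative regular local ring, then `G₀(A)` is
infinite cyclic generated by the class `[A]`: there is a group isomorphism
`G₀(A) ≃ ℤ` sending `[A]` to `1`. -/
theorem G0_equiv_int_of_regular_local (A : Type u) [CommRing A] [IsLocalRing A]
    (hreg : IsRegularLocal A) :
    ∃ φ : G0 A ≃+ ℤ, φ (G0.of A) = 1 := by
  have := hreg.1
  have : IsRegularLocalRing A :=
    (IsRegularLocalRing.iff_finrank_cotangentSpace A).mpr hreg.2.symm
  obtain ⟨_, hfree⟩ := IsRegularLocalRing.isDomain_and_hasFreeSyzygy _ (R := A) rfl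
  have htop := G0.zmultiples_of_self_eq_top fun M _ _ _ => G0.of_mem_zmultiples _ M (hfree M)
  refine ⟨AddEquiv.ofBijective (G0.rank A) ⟨?_, fun m => ?_⟩, G0.rank_of_self⟩
  · rw [injective_iff_map_eq_zero]
    intro y hy
    obtain ⟨m, rfl⟩ := AddSubgroup.mem_zmultiples_iff.mp (htop ▸ AddSubgroup.mem_top y)
    rw [map_zsmul, G0.rank_of_self] at hy
    simp_all
  · exact ⟨m • G0.of A, by rw [map_zsmul, G0.rank_of_self]; simp⟩
end
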